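/- arXiv:1502.04473 — 2 statements merged into one kernel-verified Lean document; each statement's English description precedes it below -/
import Mathlib

section
/- Let A1, A2 : ℝ² → M₂(ℝ) be continuously differentiable with A1(x), A2(x) symmetric for all x, let γ ≥ 0 be such that ⟨(∂₁A1(x) + ∂₂A2(x))·v, v⟩ ≤ 2γ|v|² for all x ∈ ℝ² and v ∈ ℝ², let ρ : ℝ² → ℝ be continuous with ρ(x) ≥ ρ₀ for all x where ρ₀ > γ, and let ε > 0. Then for every compactly supported continuously differentiable u : ℝ² → ℝ², the bilinear-form value ∫_{ℝ²} ( ε|Du(x)|² + ⟨A1(x)·∂₁u(x) + A2(x)·∂₂u(x), u(x)⟩ + ρ(x)|u(x)|² ) dx ≥ ε ∫_{ℝ²} |Du(x)|² dx + (ρ₀ − γ) ∫_{ℝ²} |u(x)|² dx; in particular the form is coercive. -/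
open MeasureTheory Matrix


lemma cd_integral_fderiv_zero (g : (Fin 2 → ℝ) → ℝ) (hg : ContDiff ℝ 1 g)
    (hc : HasCompactSupport g) (v : Fin 2 → ℝ) :
    Integrable (fun x => fderiv ℝ g x v) ∧ ∫ x, fderiv ℝ g x v = 0 := by
  have hcont : Continuous (fun x => fderiv ℝ g x v) :=
    (hg.continuous_fderiv one_ne_zero).clm_apply continuous_const
  have hint : Integrable (fun x => fderiv ℝ g x v) :=
    hcont.integrable_of_hasCompactSupport (hc.fderiv_apply (𝕜 := ℝ) v)
  refine ⟨hint, ?_⟩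
  have h := integral_mul_fderiv_eq_neg_fderiv_mul_of_integrable
    (μ := (volume : Measure (Fin 2 → ℝ))) (f := fun _ => (1 : ℝ)) (g := g) (v := v)
    (by simp) (by simpa using hint)
    (by simpa using hg.continuous.integrable_of_hasCompactSupport hc)
    (fun x _ => differentiableAt_const _)
    (fun x _ => hg.differentiable one_ne_zero x)
  simpa using h

lemma cd_quad_contDiff (A : (Fin 2 → ℝ) → Matrix (Fin 2) (Fin 2) ℝ)
    (hA : ∀ i j, ContDiff ℝ 1 fun x => A x i j)
    (u : (Fin 2 → ℝ) → (Fin 2 → ℝ)) (hu : ContDiff ℝ 1 u) :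
    ContDiff ℝ 1 (fun y => (A y *ᵥ u y) ⬝ᵥ u y) := by
  have hui : ∀ i, ContDiff ℝ 1 fun x => u x i := fun i => contDiff_pi.1 hu i
  simp only [mulVec, dotProduct, Fin.sum_univ_two]
  have := hui 0
  have := hui 1
  have := hA 0 0
  have := hA 0 1
  have := hA 1 0
  have := hA 1 1
  fun_prop

lemma cd_quad_fderiv (A : (Fin 2 → ℝ) → Matrix (Fin 2) (Fin 2) ℝ)
    (hA : ∀ i j, ContDiff ℝ 1 fun x => A x i j) (hs : ∀ x, (A x).IsSymm)
    (u : (Fin 2 → ℝ) → (Fin 2 → ℝ)) (hu : ContDiff ℝ 1 u) (x v : Fin 2 → ℝ) :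
    fderiv ℝ (fun y => (A y *ᵥ u y) ⬝ᵥ u y) x v =
      ((Matrix.of fun i j => fderiv ℝ (fun y => A y i j) x v) *ᵥ u x) ⬝ᵥ u x
      + 2 * ((A x *ᵥ fderiv ℝ u x v) ⬝ᵥ u x) := by
  have hu' : HasFDerivAt u (fderiv ℝ u x) x := (hu.differentiable one_ne_zero x).hasFDerivAt
  have hui := hasFDerivAt_pi'.1 hu'
  have hAi : ∀ i j, HasFDerivAt (fun y => A y i j) (fderiv ℝ (fun y => A y i j) x) x :=
    fun i j => ((hA i j).differentiable one_ne_zero x).hasFDerivAt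
  have hsx : A x 1 0 = A x 0 1 := (hs x).apply 0 1
  have key := ((((hAi 0 0).mul (hui 0)).add ((hAi 0 1).mul (hui 1))).mul (hui 0)).add
    ((((hAi 1 0).mul (hui 0)).add ((hAi 1 1).mul (hui 1))).mul (hui 1))
  have heq : (fun y => (A y *ᵥ u y) ⬝ᵥ u y) = (fun y =>
      (A y 0 0 * u y 0 + A y 0 1 * u y 1) * u y 0
      + (A y 1 0 * u y 0 + A y 1 1 * u y 1) * u y 1) := by
    funext y
    simp only [mulVec, dotProduct, Fin.sum_univ_two]
  rw [heq]
  refine (congrArg (fun L => L v) key.fderiv).trans ?_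
  simp [mulVec, dotProduct, Fin.sum_univ_two, hsx]
  ring

/-- Coercivity of the bilinear form of the convection-diffusion system
`-εΔu + A1 ∂₁u + A2 ∂₂u + ρu = f` under the standing assumption
`ρ ≥ ρ₀ > γ ≥ (1/2)‖div A‖`. -/
theorem convection_diffusion_form_coercive
    (A1 A2 : (Fin 2 → ℝ) → Matrix (Fin 2) (Fin 2) ℝ)
    (hA1 : ∀ i j, ContDiff ℝ 1 fun x => A1 x i j)
    (hA2 : ∀ i j, ContDiff ℝ 1 fun x => A2 x i j)
    (hsym1 : ∀ x, (A1 x).IsSymm)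
    (hsym2 : ∀ x, (A2 x).IsSymm)
    (γ : ℝ) (hγ : 0 ≤ γ)
    (hdiv : ∀ (x v : Fin 2 → ℝ),
      ((Matrix.of fun i j =>
          fderiv ℝ (fun y => A1 y i j) x (Pi.single 0 1)
            + fderiv ℝ (fun y => A2 y i j) x (Pi.single 1 1)) *ᵥ v) ⬝ᵥ v
        ≤ 2 * γ * (v ⬝ᵥ v))
    (ρ : (Fin 2 → ℝ) → ℝ) (hρcont : Continuous ρ)
    (ρ₀ : ℝ) (hρ : ∀ x, ρ₀ ≤ ρ x) (hρ₀ : γ < ρ₀)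
    (ε : ℝ) (hε : 0 < ε)
    (u : (Fin 2 → ℝ) → (Fin 2 → ℝ))
    (hu : ContDiff ℝ 1 u)
    (hsupp : HasCompactSupport u) :
    ε * (∫ x : Fin 2 → ℝ,
          (fderiv ℝ u x (Pi.single 0 1) ⬝ᵥ fderiv ℝ u x (Pi.single 0 1)
            + fderiv ℝ u x (Pi.single 1 1) ⬝ᵥ fderiv ℝ u x (Pi.single 1 1)))
      + (ρ₀ - γ) * (∫ x : Fin 2 → ℝ, u x ⬝ᵥ u x)
    ≤ ∫ x : Fin 2 → ℝ,
        (ε * (fderiv ℝ u x (Pi.single 0 1) ⬝ᵥ fderiv ℝ u x (Pi.single 0 1)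
              + fderiv ℝ u x (Pi.single 1 1) ⬝ᵥ fderiv ℝ u x (Pi.single 1 1))
          + ((A1 x) *ᵥ (fderiv ℝ u x (Pi.single 0 1))
              + (A2 x) *ᵥ (fderiv ℝ u x (Pi.single 1 1))) ⬝ᵥ u x
          + ρ x * (u x ⬝ᵥ u x)) := by
  have hdu : ∀ v, Continuous fun x => fderiv ℝ u x v := fun v =>
    (hu.continuous_fderiv one_ne_zero).clm_apply continuous_const
  have hu0 : ∀ x, x ∉ tsupport u → u x = 0 := fun x hx => image_eq_zero_of_notMem_tsupport hx
  have hdu0 : ∀ x, x ∉ tsupport u → fderiv ℝ u x = 0 := fun x hx =>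
    image_eq_zero_of_notMem_tsupport fun h => hx (tsupport_fderiv_subset ℝ h)
  have hA1c : Continuous A1 := continuous_matrix fun i j => (hA1 i j).continuous
  have hA2c : Continuous A2 := continuous_matrix fun i j => (hA2 i j).continuous
  have huc := hu.continuous
  have hd0 := hdu (Pi.single 0 1)
  have hd1 := hdu (Pi.single 1 1)
  have hF : ∀ A : (Fin 2 → ℝ) → Matrix (Fin 2) (Fin 2) ℝ,
      HasCompactSupport (fun y => (A y *ᵥ u y) ⬝ᵥ u y) := fun A =>
    HasCompactSupport.intro hsupp fun x hx => by simp [hu0 x hx]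
  obtain ⟨i1, z1⟩ := cd_integral_fderiv_zero _ (cd_quad_contDiff A1 hA1 u hu) (hF A1)
    (Pi.single 0 1)
  obtain ⟨i2, z2⟩ := cd_integral_fderiv_zero _ (cd_quad_contDiff A2 hA2 u hu) (hF A2)
    (Pi.single 1 1)
  have iD : Integrable (fun x : Fin 2 → ℝ =>
      (fderiv ℝ u x (Pi.single 0 1) ⬝ᵥ fderiv ℝ u x (Pi.single 0 1)
            + fderiv ℝ u x (Pi.single 1 1) ⬝ᵥ fderiv ℝ u x (Pi.single 1 1))) := by
    refine Continuous.integrable_of_hasCompactSupport ?_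
      (HasCompactSupport.intro hsupp fun x hx => by simp [hdu0 x hx])
    exact (hd0.dotProduct hd0).add (hd1.dotProduct hd1)
  have iU : Integrable (fun x : Fin 2 → ℝ => u x ⬝ᵥ u x) :=
    (huc.dotProduct huc).integrable_of_hasCompactSupport
      (HasCompactSupport.intro hsupp fun x hx => by simp [hu0 x hx])
  have iR : Integrable (fun x : Fin 2 → ℝ =>
        (ε * (fderiv ℝ u x (Pi.single 0 1) ⬝ᵥ fderiv ℝ u x (Pi.single 0 1)
              + fderiv ℝ u x (Pi.single 1 1) ⬝ᵥ fderiv ℝ u x (Pi.single 1 1))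
          + ((A1 x) *ᵥ (fderiv ℝ u x (Pi.single 0 1))
              + (A2 x) *ᵥ (fderiv ℝ u x (Pi.single 1 1))) ⬝ᵥ u x
          + ρ x * (u x ⬝ᵥ u x))) := by
    refine Continuous.integrable_of_hasCompactSupport ?_
      (HasCompactSupport.intro hsupp fun x hx => by simp [hdu0 x hx, hu0 x hx])
    exact ((continuous_const.mul ((hd0.dotProduct hd0).add (hd1.dotProduct hd1))).add
      (((hA1c.matrix_mulVec hd0).add (hA2c.matrix_mulVec hd1)).dotProduct huc)).add
      (hρcont.mul (huc.dotProduct huc))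
  have iL := (iD.const_mul ε).add (iU.const_mul (ρ₀ - γ))
  have iS := (i1.add i2).const_mul (1 / 2)
  have hmono := integral_mono (iL.add iS) iR (fun x => by
    have hd := hdiv x (u x)
    have hn : 0 ≤ u x ⬝ᵥ u x := by
      simp only [dotProduct, Fin.sum_univ_two]
      nlinarith [mul_self_nonneg (u x 0), mul_self_nonneg (u x 1)]
    have hr := mul_le_mul_of_nonneg_right (hρ x) hn
    have e : (Matrix.of fun i j =>
          fderiv ℝ (fun y => A1 y i j) x (Pi.single 0 1)
            + fderiv ℝ (fun y => A2 y i j) x (Pi.single 1 1))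
        = (Matrix.of fun i j => fderiv ℝ (fun y => A1 y i j) x (Pi.single 0 1))
          + (Matrix.of fun i j => fderiv ℝ (fun y => A2 y i j) x (Pi.single 1 1)) := rfl
    rw [e, Matrix.add_mulVec, add_dotProduct] at hd
    simp only [Pi.add_apply]
    rw [cd_quad_fderiv A1 hA1 hsym1 u hu, cd_quad_fderiv A2 hA2 hsym2 u hu, add_dotProduct]
    linarith)
  rw [integral_add' iL iS, integral_add' (iD.const_mul ε) (iU.const_mul (ρ₀ - γ)),
    integral_const_mul, integral_const_mul, integral_const_mul, integral_add' i1 i2, z1, z2] at hmono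
  linarith
end

section
/- Let L = [[1, 0], [q, 1]] with q ∈ ℝ, let d¹ = (d₁¹, d₂¹) and d² = (d₁², d₂²) be vectors in ℝ², and suppose A1 = L·diag(d₁¹, d₁²)·Lᵀ and A2 = L·diag(d₂¹, d₂²)·Lᵀ. Let ε₁, ε₂ > 0, E = diag(ε₁, ε₂), ρ ∈ ℝ, and f : ℝ² → ℝ² continuous, and let E* = L⁻¹E(Lᵀ)⁻¹ = [[ε₁, −ε₁q],[−ε₁q, ε₁q² + ε₂]]. Then for every twice continuously differentiable u : ℝ² → ℝ², setting v = Lᵀu (components v₁, v₂), u satisfies −EΔu + A1∂₁u + A2∂₂u + ρu = f on ℝ² if and only if −E*₁₁Δv₁ − E*₁₂Δv₂ + d¹·∇v₁ + (ρ L⁻¹(Lᵀ)⁻¹v)₁ = (L⁻¹f)₁ and −E*₂₁Δv₁ − E*₂₂Δv₂ + d²·∇v₂ + (ρ L⁻¹(Lᵀ)⁻¹v)₂ = (L⁻¹f)₂ on ℝ². -/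
open Matrix

/-- Partial derivative of a vector-valued function on `ℝ²` in direction `i`. -/
noncomputable def pdV (i : Fin 2) (g : (Fin 2 → ℝ) → (Fin 2 → ℝ)) :
    (Fin 2 → ℝ) → (Fin 2 → ℝ) :=
  fun x => fderiv ℝ g x (Pi.single i 1)

/-- Partial derivative of a scalar function on `ℝ²` in direction `i`. -/
noncomputable def pdS (i : Fin 2) (g : (Fin 2 → ℝ) → ℝ) :
    (Fin 2 → ℝ) → ℝ :=
  fun x => fderiv ℝ g x (Pi.single i 1)

lemma pdV_apply_aux (i j : Fin 2) (g : (Fin 2 → ℝ) → (Fin 2 → ℝ)) (hg : Differentiable ℝ g)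
    (x : Fin 2 → ℝ) : pdV i g x j = pdS i (fun y => g y j) x := by
  unfold pdV pdS
  have h := (hasFDerivAt_pi'.1 (hg x).hasFDerivAt j).fderiv
  rw [h]
  rfl

lemma pdS_lin_aux (i : Fin 2) (q : ℝ) (a b : (Fin 2 → ℝ) → ℝ) (ha : Differentiable ℝ a)
    (hb : Differentiable ℝ b) :
    pdS i (fun y => a y + q * b y) = fun y => pdS i a y + q * pdS i b y := by
  funext x
  unfold pdS
  have h := ((ha x).hasFDerivAt.add ((hb x).hasFDerivAt.const_mul q)).fderiv
  have h2 : fderiv ℝ (fun y => a y + q * b y) x = fderiv ℝ a x + q • fderiv ℝ b x := h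
  rw [h2]
  simp

lemma pdV_diff_aux (i : Fin 2) (u : (Fin 2 → ℝ) → (Fin 2 → ℝ)) (hu : ContDiff ℝ 2 u) :
    Differentiable ℝ (pdV i u) := by
  have h : ContDiff ℝ 1 (fderiv ℝ u) := hu.fderiv_right (by norm_num)
  exact (h.differentiable (by norm_num)).clm_apply (differentiable_const _)

/-- Two-parameter 2D decoupling of the convection part: if
`A1 = L diag(d₁¹, d₁²) Lᵀ` and `A2 = L diag(d₂¹, d₂²) Lᵀ` with
`L = [[1,0],[q,1]]`, then with `v = Lᵀu` and
`E* = L⁻¹ diag(ε₁,ε₂) (Lᵀ)⁻¹ = [[ε₁, -ε₁q],[-ε₁q, ε₁q² + ε₂]]`, the system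
`-EΔu + A1∂₁u + A2∂₂u + ρu = f` is equivalent to the transformed system
whose convection terms `d¹·∇v₁`, `d²·∇v₂` are decoupled. -/
theorem two_parameter_2D_decoupling
    (q : ℝ) (L : Matrix (Fin 2) (Fin 2) ℝ) (hL : L = !![1, 0; q, 1])
    (d₁1 d₂1 d₁2 d₂2 : ℝ)
    (A1 A2 : Matrix (Fin 2) (Fin 2) ℝ)
    (hA1 : A1 = L * Matrix.diagonal ![d₁1, d₁2] * Lᵀ)
    (hA2 : A2 = L * Matrix.diagonal ![d₂1, d₂2] * Lᵀ)
    (ε₁ ε₂ : ℝ) (hε₁ : 0 < ε₁) (hε₂ : 0 < ε₂)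
    (E Estar : Matrix (Fin 2) (Fin 2) ℝ)
    (hE : E = Matrix.diagonal ![ε₁, ε₂])
    (hEstar : Estar = L⁻¹ * E * (Lᵀ)⁻¹)
    (ρ : ℝ) (f : (Fin 2 → ℝ) → (Fin 2 → ℝ)) (hf : Continuous f)
    (u : (Fin 2 → ℝ) → (Fin 2 → ℝ)) (hu : ContDiff ℝ 2 u) :
    Estar = !![ε₁, -ε₁ * q; -ε₁ * q, ε₁ * q ^ 2 + ε₂]
      ∧ ((∀ x : Fin 2 → ℝ,
            -(E *ᵥ (pdV 0 (pdV 0 u) x + pdV 1 (pdV 1 u) x))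
              + A1 *ᵥ (pdV 0 u x) + A2 *ᵥ (pdV 1 u x) + ρ • u x = f x)
          ↔ (∀ x : Fin 2 → ℝ,
              (-(Estar 0 0 * (pdS 0 (pdS 0 fun y => (Lᵀ *ᵥ u y) 0) x
                    + pdS 1 (pdS 1 fun y => (Lᵀ *ᵥ u y) 0) x))
                - Estar 0 1 * (pdS 0 (pdS 0 fun y => (Lᵀ *ᵥ u y) 1) x
                    + pdS 1 (pdS 1 fun y => (Lᵀ *ᵥ u y) 1) x)
                + (d₁1 * pdS 0 (fun y => (Lᵀ *ᵥ u y) 0) x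
                    + d₂1 * pdS 1 (fun y => (Lᵀ *ᵥ u y) 0) x)
                + ρ * (((L⁻¹ * (Lᵀ)⁻¹) *ᵥ (Lᵀ *ᵥ u x)) 0)
                = (L⁻¹ *ᵥ f x) 0)
              ∧ (-(Estar 1 0 * (pdS 0 (pdS 0 fun y => (Lᵀ *ᵥ u y) 0) x
                    + pdS 1 (pdS 1 fun y => (Lᵀ *ᵥ u y) 0) x))
                - Estar 1 1 * (pdS 0 (pdS 0 fun y => (Lᵀ *ᵥ u y) 1) x
                    + pdS 1 (pdS 1 fun y => (Lᵀ *ᵥ u y) 1) x)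
                + (d₁2 * pdS 0 (fun y => (Lᵀ *ᵥ u y) 1) x
                    + d₂2 * pdS 1 (fun y => (Lᵀ *ᵥ u y) 1) x)
                + ρ * (((L⁻¹ * (Lᵀ)⁻¹) *ᵥ (Lᵀ *ᵥ u x)) 1)
                = (L⁻¹ *ᵥ f x) 1))) := by
  have hLi : L⁻¹ = !![1, 0; -q, 1] := by
    apply Matrix.inv_eq_right_inv
    subst hL
    ext i j; fin_cases i <;> fin_cases j <;> simp [Matrix.mul_apply, Fin.sum_univ_two]
  have hLti : (Lᵀ)⁻¹ = !![1, -q; 0, 1] := by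
    apply Matrix.inv_eq_right_inv
    subst hL
    ext i j; fin_cases i <;> fin_cases j <;> simp [Matrix.mul_apply, Fin.sum_univ_two]
  have hEs : Estar = !![ε₁, -ε₁ * q; -ε₁ * q, ε₁ * q ^ 2 + ε₂] := by
    rw [hEstar, hLi, hLti, hE]
    ext i j; fin_cases i <;> fin_cases j <;>
      simp [Matrix.mul_apply, Fin.sum_univ_two, Matrix.diagonal, vecHead, vecTail] <;> ring
  refine ⟨hEs, ?_⟩
  have hud : Differentiable ℝ u := hu.differentiable (by norm_num)
  have hc : ∀ j, Differentiable ℝ (fun y => u y j) := fun j => differentiable_pi.1 hud j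
  have hp : ∀ i j, (fun y => pdV i u y j) = pdS i (fun y => u y j) := fun i j =>
    funext fun y => pdV_apply_aux i j u hud y
  have hpd : ∀ i j, Differentiable ℝ (pdS i (fun y => u y j)) := fun i j => by
    rw [← hp]; exact differentiable_pi.1 (pdV_diff_aux i u hu) j
  have hpp : ∀ i j x, pdV i (pdV i u) x j = pdS i (pdS i (fun y => u y j)) x := fun i j x => by
    rw [pdV_apply_aux i j _ (pdV_diff_aux i u hu), hp]
  have hp1 : ∀ i j x, pdV i u x j = pdS i (fun y => u y j) x := fun i j x =>
    pdV_apply_aux i j u hud x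
  have hv0 : (fun y => (Lᵀ *ᵥ u y) 0) = fun y => u y 0 + q * u y 1 := by
    funext y; simp [hL, Matrix.mulVec, dotProduct, Fin.sum_univ_two]
  have hv1 : (fun y => (Lᵀ *ᵥ u y) 1) = fun y => u y 1 := by
    funext y; simp [hL, Matrix.mulVec, dotProduct, Fin.sum_univ_two]
  have hl1 : ∀ i, pdS i (fun y => u y 0 + q * u y 1) = fun y =>
      pdS i (fun y => u y 0) y + q * pdS i (fun y => u y 1) y := fun i =>
    pdS_lin_aux i q _ _ (hc 0) (hc 1)
  have hl2 : ∀ i, pdS i (fun y => pdS i (fun y => u y 0) y + q * pdS i (fun y => u y 1) y)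
      = fun y => pdS i (pdS i (fun y => u y 0)) y + q * pdS i (pdS i (fun y => u y 1)) y :=
    fun i => pdS_lin_aux i q _ _ (hpd i 0) (hpd i 1)
  rw [hv0, hv1]
  simp only [hl1, hl2]
  refine forall_congr' fun x => ?_
  rw [funext_iff, Fin.forall_fin_two, hEs, hLi, hLti, hA1, hA2, hE, hL]
  simp only [Matrix.mulVec, dotProduct, Fin.sum_univ_two, Matrix.mul_apply, Matrix.diagonal,
    Pi.add_apply, Pi.neg_apply, Pi.smul_apply, hpp, hp1, smul_eq_mul, Matrix.transpose_apply]
  simp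
  constructor
  · rintro ⟨h0, h1⟩
    exact ⟨by linear_combination h0, by linear_combination h1 - q * h0⟩
  · rintro ⟨h0, h1⟩
    exact ⟨by linear_combination h0, by linear_combination h1 + q * h0⟩
end
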